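/- Every infinite virtually cyclic group admits either a surjective homomorphism onto the infinite cyclic group ℤ with finite kernel, or a surjective homomorphism onto the infinite dihedral group with finite kernel. -/

import Mathlib

open Monoid.Coprod in
/-- The infinite dihedral group `DihedralGroup 0` is the free product `ℤ/2 ∗ ℤ/2`. -/
theorem nonempty_dihedralGroup_zero_mulEquiv_coprod :
    Nonempty (DihedralGroup 0 ≃*
      Monoid.Coprod (Multiplicative (ZMod 2)) (Multiplicative (ZMod 2))) := by
  let z : Multiplicative (ZMod 2) := Multiplicative.ofAdd 1
  have hz : z * z = 1 := by decide
  have hz1 : z ≠ 1 := by decide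
  have hcases : ∀ w : Multiplicative (ZMod 2), w = 1 ∨ w = z := by decide
  let a : Monoid.Coprod (Multiplicative (ZMod 2)) (Multiplicative (ZMod 2)) := inl z
  let b : Monoid.Coprod (Multiplicative (ZMod 2)) (Multiplicative (ZMod 2)) := inr z
  have ha : a * a = 1 := by rw [← map_mul, hz, map_one]
  have hb : b * b = 1 := by rw [← map_mul, hz, map_one]
  have ha' : a⁻¹ = a := inv_eq_of_mul_eq_one_left ha
  have hb' : b⁻¹ = b := inv_eq_of_mul_eq_one_left hb
  have hinv : a * (a * b) * a⁻¹ = (a * b)⁻¹ := by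
    rw [mul_inv_rev, ha', hb', ← mul_assoc, ha, one_mul]
  let p : ZMod 0 → Monoid.Coprod (Multiplicative (ZMod 2)) (Multiplicative (ZMod 2)) :=
    fun i : ℤ => (a * b) ^ i
  have hp (i j : ZMod 0) : p (i + j) = p i * p j := zpow_add (a * b) _ _
  have hconj' (i : ℤ) : (a * b) ^ i * a = a * (a * b) ^ (-i) := by
    rw [zpow_neg, ← inv_zpow, ← hinv, conj_zpow, ha', ← mul_assoc, ← mul_assoc, ha, one_mul]
  have hconj (i : ZMod 0) : p i * a = a * p (-i) := hconj' i
  let g : DihedralGroup 0 →* Monoid.Coprod (Multiplicative (ZMod 2)) (Multiplicative (ZMod 2)) :=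
    { toFun := fun x => match x with
        | .r i => p i
        | .sr i => a * p i
      map_one' := zpow_zero _
      map_mul' := by
        rintro (i | i) (j | j)
        · exact hp _ _
        · change a * p (j - i) = p i * (a * p j)
          rw [← mul_assoc, hconj, mul_assoc, ← hp, neg_add_eq_sub]
        · change a * p (i + j) = a * p i * p j
          rw [mul_assoc, ← hp]
        · change p (j - i) = a * p i * (a * p j)
          rw [mul_assoc, ← mul_assoc (p i), hconj, mul_assoc, ← mul_assoc a a, ha,
            one_mul, ← hp, neg_add_eq_sub] }
  let reflection (i : ZMod 0) : Multiplicative (ZMod 2) →* DihedralGroup 0 :=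
    { toFun := fun x => if x = 1 then 1 else .sr i
      map_one' := if_pos rfl
      map_mul' := by
        intro x y
        rcases hcases x with rfl | rfl <;> rcases hcases y with rfl | rfl <;> simp [hz, hz1] }
  let f := lift (reflection 0) (reflection 1)
  have hfa : f a = .sr 0 := by
    simp only [f, a, lift_apply_inl]
    rfl
  have hfb : f b = .sr 1 := by
    simp only [f, b, lift_apply_inr]
    rfl
  have hfp (i : ZMod 0) : f (p i) = .r i := by
    refine (map_zpow f (a * b) i).trans ?_
    rw [map_mul, hfa, hfb, DihedralGroup.sr_mul_sr, sub_zero]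
    exact (DihedralGroup.r_one_zpow i).trans (congrArg DihedralGroup.r Int.cast_id)
  have hfg : f.comp g = MonoidHom.id _ := by
    ext (i | i)
    · exact hfp i
    · change f (a * p i) = _
      rw [map_mul, hfp, hfa, DihedralGroup.sr_mul_r, zero_add]
      rfl
  have hgf : g.comp f = MonoidHom.id _ := by
    apply Monoid.Coprod.hom_ext <;> refine MonoidHom.ext fun x => ?_ <;>
      rcases hcases x with rfl | rfl
    · simp only [map_one]
    · change g (f a) = a
      rw [hfa]
      exact (congrArg (a * ·) (zpow_zero _)).trans (mul_one a)
    · simp only [map_one]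
    · change g (f b) = b
      rw [hfb]
      refine (congrArg (a * ·) (zpow_one _)).trans ?_
      rw [← mul_assoc, ha, one_mul]
  exact ⟨MonoidHom.toMulEquiv g f hfg hgf⟩

/-- A group with a central infinite cyclic subgroup `Z` of finite index maps onto `ℤ` with finite
kernel, in such a way that any endomorphism inverting `Z` acts by inversion on `ℤ`. -/
theorem exists_surjective_int_of_central_cyclic {C : Type*} [Group C] (Z : Subgroup C)
    [IsCyclic Z] [Infinite Z] [Z.FiniteIndex] (hZ : Z ≤ Subgroup.center C) :
    ∃ τ : C →* Multiplicative ℤ, Function.Surjective τ ∧ Finite τ.ker ∧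
      ∀ σ : C →* C, (∀ z ∈ Z, σ z = z⁻¹) → ∀ c, τ (σ c) = (τ c)⁻¹ := by
  have e : Z ≃* Multiplicative ℤ := intCyclicMulEquiv.symm
  have key (c : C) (k : ℕ) (g : C) (hk : g⁻¹ * c ^ k * g ∈ Z) : g⁻¹ * c ^ k * g = c ^ k := by
    have h := Subgroup.mem_center_iff.mp (hZ hk) g
    exact (mul_right_cancel ((by group : c ^ k * g = g * (g⁻¹ * c ^ k * g)).trans h)).symm
  let t : C →* Multiplicative ℤ := MonoidHom.transfer e.toMonoidHom
  have hmem (c : C) : c ^ Z.index ∈ Z := MonoidHom.transfer_eq_pow_aux c (key c)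
  have ht (c : C) : t c = e ⟨c ^ Z.index, hmem c⟩ :=
    MonoidHom.transfer_eq_pow e.toMonoidHom c (key c)
  have htZ (z : Z) : t z = e z ^ Z.index := by
    rw [ht, ← map_pow]
    rfl
  have hinj : Function.Injective (fun z : Z => t z) := fun x y h => by
    simp only [htZ] at h
    exact e.injective (pow_left_injective Subgroup.FiniteIndex.index_ne_zero h)
  have hker : Finite t.ker := by
    refine Finite.of_injective (fun k : t.ker => (k : C ⧸ Z)) fun x y h => ?_
    have h1 : (x : C)⁻¹ * y ∈ Z := QuotientGroup.eq.mp h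
    have h2 : t ((x : C)⁻¹ * y) = t (1 : Z) := by
      rw [map_mul, map_inv, x.2, y.2]
      simp
    have h3 := congrArg Subtype.val (@hinj ⟨_, h1⟩ 1 h2)
    exact Subtype.ext (inv_mul_eq_one.mp h3)
  have : Infinite t.range := Infinite.of_injective
    (fun z : Z => (⟨t z, z, rfl⟩ : t.range)) fun x y h => hinj (congrArg Subtype.val h)
  let r : t.range ≃* Multiplicative ℤ := intCyclicMulEquiv.symm
  refine ⟨(r : t.range →* Multiplicative ℤ).comp t.rangeRestrict,
    r.surjective.comp t.rangeRestrict_surjective, ?_, fun σ hσ c => ?_⟩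
  · rwa [MonoidHom.ker_mulEquiv_comp, MonoidHom.ker_rangeRestrict]
  · have h : t (σ c) = (t c)⁻¹ := by
      rw [ht, ht, ← map_inv]
      exact congrArg e (Subtype.ext ((map_pow σ c _).symm.trans (hσ _ (hmem c))))
    exact (congrArg r (Subtype.ext h)).trans (map_inv r _)

/-- Conjugation acts on an infinite cyclic normal subgroup trivially or by inversion. -/
theorem conj_eq_self_or_inv_of_isCyclic {G : Type*} [Group G] (N : Subgroup G) [N.Normal]
    [IsCyclic N] [Infinite N] (g : G) :
    (∀ x ∈ N, g * x * g⁻¹ = x) ∨ ∀ x ∈ N, g * x * g⁻¹ = x⁻¹ := by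
  obtain ⟨t, ht⟩ := IsCyclic.exists_generator (α := N)
  have hinj : Function.Injective (fun k : ℤ => t ^ k) :=
    (zpowersHom_bijective (Subgroup.eq_top_iff' _ |>.mpr ht)).injective
  obtain ⟨k, hk⟩ := ht (MulAut.conjNormal g t)
  obtain ⟨l, hl⟩ := ht (MulAut.conjNormal g⁻¹ t)
  have hkl : l * k = 1 := by
    apply hinj
    simp only [zpow_mul, zpow_one] at *
    rw [hl, ← map_zpow, hk, ← MulAut.mul_apply, ← map_mul]
    simp
  have hx (x : G) (hx : x ∈ N) : ∃ m : ℤ, x = (t : G) ^ m ∧ g * x * g⁻¹ = ((t : G) ^ k) ^ m := by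
    obtain ⟨m, hm⟩ := ht ⟨x, hx⟩
    have hm' : (t : G) ^ m = x := by simpa using congrArg Subtype.val hm
    have hk' : (t : G) ^ k = g * t * g⁻¹ := by simpa using congrArg Subtype.val hk
    exact ⟨m, hm'.symm, by rw [← hm', hk', conj_zpow]⟩
  rcases Int.eq_one_or_neg_one_of_mul_eq_one' hkl with ⟨-, rfl⟩ | ⟨-, rfl⟩
  · left
    intro x h
    obtain ⟨m, rfl, h⟩ := hx x h
    rw [h, zpow_one]
  · right
    intro x h
    obtain ⟨m, rfl, h⟩ := hx x h
    rw [h, zpow_neg_one, inv_zpow]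

/-- A homomorphism from an index-two subgroup `C` onto `ℤ` which is inverted by an element `s`
outside `C` extends to a homomorphism onto the infinite dihedral group with finite kernel. -/
theorem exists_surjective_dihedralGroup_zero {G : Type*} [Group G] (C : Subgroup G) [C.Normal]
    (s : G) (hs : s ∉ C) (hC : ∀ g ∉ C, s⁻¹ * g ∈ C)
    (τ : C →* Multiplicative ℤ) (hτ : Function.Surjective τ) [Finite τ.ker]
    (hinv : ∀ c, τ (MulAut.conjNormal s c) = (τ c)⁻¹) :
    ∃ ψ : G →* DihedralGroup 0, Function.Surjective ψ ∧ Finite ψ.ker := by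
  classical
  have hs2 : s * s ∈ C := by
    by_contra h
    exact hs (by simpa using hC _ h)
  have hinv' (c) : τ (MulAut.conjNormal s⁻¹ c) = (τ c)⁻¹ := by
    rw [← inv_inj, ← hinv, ← MulAut.mul_apply, ← map_mul]
    simp
  have hτ2 : τ ⟨s * s, hs2⟩ = 1 := by
    have h := hinv ⟨s * s, hs2⟩
    have h' : MulAut.conjNormal s (⟨s * s, hs2⟩ : C) = ⟨s * s, hs2⟩ :=
      Subtype.ext (by simp [mul_assoc])
    rw [h'] at h
    exact self_eq_inv.mp h
  let v (c : C) : ZMod 0 := (τ c).toAdd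
  have hv (c d : C) : v (c * d) = v c + v d := congrArg Multiplicative.toAdd (map_mul τ c d)
  have hv_conj (c : C) : v (MulAut.conjNormal s⁻¹ c) = -v c :=
    congrArg Multiplicative.toAdd (hinv' c)
  have hv2 : v ⟨s * s, hs2⟩ = 0 := congrArg Multiplicative.toAdd hτ2
  let ψ₀ (g : G) : DihedralGroup 0 :=
    if h : g ∈ C then .r (v ⟨g, h⟩) else .sr (v ⟨s⁻¹ * g, hC g h⟩)
  have hr (c : C) : ψ₀ c = .r (v c) := dif_pos c.2
  have hsr (c : C) : ψ₀ (s * c) = .sr (v c) := by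
    have h : s * (c : G) ∉ C := fun h => hs ((C.mul_mem_cancel_right c.2).mp h)
    simp only [ψ₀, dif_neg h, inv_mul_cancel_left]
  have hG (g : G) : (∃ c : C, g = c) ∨ ∃ c : C, g = s * c := by
    by_cases h : g ∈ C
    · exact .inl ⟨⟨g, h⟩, rfl⟩
    · exact .inr ⟨⟨_, hC g h⟩, by simp⟩
  let ψ : G →* DihedralGroup 0 := MonoidHom.mk' ψ₀ (by
    intro x y
    obtain ⟨c, rfl⟩ | ⟨c, rfl⟩ := hG x <;> obtain ⟨d, rfl⟩ | ⟨d, rfl⟩ := hG y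
    · rw [← Subgroup.coe_mul, hr, hr, hr, hv, DihedralGroup.r_mul_r]
    · have h : (c : G) * (s * d) = s * (MulAut.conjNormal s⁻¹ c * d : C) := by
        simp [mul_assoc]
      rw [h, hsr, hr, hsr, hv, hv_conj, DihedralGroup.r_mul_sr, neg_add_eq_sub]
    · rw [mul_assoc, ← Subgroup.coe_mul, hsr, hsr, hr, hv, DihedralGroup.sr_mul_r]
    · have h : s * c * (s * d) = (⟨s * s, hs2⟩ * (MulAut.conjNormal s⁻¹ c * d) : C) := by
        simp [mul_assoc]
      rw [h, hr, hsr, hsr, hv, hv, hv_conj, hv2, zero_add, DihedralGroup.sr_mul_sr,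
        neg_add_eq_sub])
  refine ⟨ψ, ?_, ?_⟩
  · rintro (i | i) <;> obtain ⟨c, hc⟩ := hτ (.ofAdd i)
    · exact ⟨c, (hr c).trans (by simp only [v, hc]; rfl)⟩
    · exact ⟨s * c, (hsr c).trans (by simp only [v, hc]; rfl)⟩
  · have hsub : (ψ.ker : Set G) ⊆ Set.range fun c : τ.ker => ((c : C) : G) := by
      intro g hg
      have hg : ψ₀ g = 1 := hg
      obtain ⟨c, rfl⟩ | ⟨c, rfl⟩ := hG g
      · rw [hr, DihedralGroup.one_def] at hg
        exact ⟨⟨c, DihedralGroup.r.inj hg⟩, rfl⟩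
      · rw [hsr, DihedralGroup.one_def] at hg
        cases hg
    exact (Set.finite_range _).subset hsub

/-- Every infinite virtually cyclic group surjects onto ℤ or onto the infinite
dihedral group `ℤ/2 ∗ ℤ/2` with finite kernel. -/
theorem infinite_virtually_cyclic_structure (G : Type*) [Group G] [Infinite G]
    (hvc : ∃ H : Subgroup G, IsCyclic H ∧ H.FiniteIndex) :
    (∃ φ : G →* Multiplicative ℤ, Function.Surjective φ ∧ Finite φ.ker) ∨
    (∃ ψ : G →* Monoid.Coprod (Multiplicative (ZMod 2)) (Multiplicative (ZMod 2)),
      Function.Surjective ψ ∧ Finite ψ.ker) := by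
  obtain ⟨H, hcyc, hfin⟩ := hvc
  let N := H.normalCore
  have : IsCyclic N := isCyclic_of_injective (Subgroup.inclusion H.normalCore_le)
    (Subgroup.inclusion_injective _)
  have hN : Infinite N := by
    by_contra h
    rw [not_infinite_iff_finite] at h
    have h1 := N.card_mul_index
    rw [Nat.card_eq_zero_of_infinite (α := G), mul_eq_zero] at h1
    exact h1.elim Nat.card_pos.ne' Subgroup.FiniteIndex.index_ne_zero
  let C := Subgroup.centralizer (N : Set G)
  have hNC : N ≤ C := Subgroup.le_centralizer_iff_isMulCommutative.mpr inferInstance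
  have hC (g : G) (hg : g ∉ C) (x : G) (hx : x ∈ N) : g * x * g⁻¹ = x⁻¹ := by
    refine (conj_eq_self_or_inv_of_isCyclic N g).resolve_left (fun h => hg ?_) x hx
    exact Subgroup.mem_centralizer_iff.mpr fun y hy => (mul_inv_eq_iff_eq_mul.mp (h y hy)).symm
  let Z := N.subgroupOf C
  let e : Z ≃* N := Subgroup.subgroupOfEquivOfLe hNC
  have : IsCyclic Z := isCyclic_of_injective e.toMonoidHom e.injective
  have : Infinite Z := e.toEquiv.infinite_iff.mpr hN
  have hZ : Z ≤ Subgroup.center C := fun z hz => Subgroup.mem_center_iff.mpr fun c =>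
    Subtype.ext (Subgroup.mem_centralizer_iff.mp c.2 z hz).symm
  obtain ⟨τ, hτ, hker, hinv⟩ := exists_surjective_int_of_central_cyclic Z hZ
  by_cases htop : C = ⊤
  · left
    let i : G ≃* C := Subgroup.topEquiv.symm.trans (MulEquiv.subgroupCongr htop.symm)
    refine ⟨τ.comp i.toMonoidHom, hτ.comp i.surjective, ?_⟩
    exact Finite.of_injective (fun x : (τ.comp i.toMonoidHom).ker => (⟨i x, x.2⟩ : τ.ker))
      fun x y h => Subtype.ext (i.injective (congrArg Subtype.val h))
  · right
    obtain ⟨s, hs⟩ : ∃ s, s ∉ C := by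
      by_contra! h
      exact htop ((Subgroup.eq_top_iff' C).mpr h)
    have hsC (g : G) (hg : g ∉ C) : s⁻¹ * g ∈ C := by
      refine Subgroup.mem_centralizer_iff.mpr fun x hx => ?_
      have h := (hC g hg x hx).trans (hC s hs x hx).symm
      rw [mul_inv_eq_iff_eq_mul] at h
      rw [mul_assoc, eq_inv_mul_iff_mul_eq, h]
      group
    obtain ⟨ψ, hψ, hψker⟩ := exists_surjective_dihedralGroup_zero C s hs hsC τ hτ
      (hinv (MulAut.conjNormal s : MulAut C).toMonoidHom fun z hz => Subtype.ext (hC s hs z hz))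
    obtain ⟨f⟩ := nonempty_dihedralGroup_zero_mulEquiv_coprod
    refine ⟨(f : DihedralGroup 0 →* _).comp ψ, f.surjective.comp hψ, ?_⟩
    rwa [MonoidHom.ker_mulEquiv_comp]
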